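/- Let z be a smooth doubly periodic function on ℝ² and ż a smooth doubly periodic function with M_z ż = 0. Suppose there exist a smooth doubly periodic function z̃ and a quadratic form q with coefficients (e,f,g) such that M_z(z̃ + q) = 0. Let E₁₁ = −∫ z₁ż₁, E₂₂ = −∫ z₂ż₂, 2E₁₂ = −∫ (z₁ż₂ + z₂ż₁), where ∫ is the mean value over a period cell. Then E₁₁·g + E₂₂·e − 2E₁₂·f = 0. -/

import Mathlib

open MeasureTheory

/-- First partial derivative (direction `(1,0)`). -/
noncomputable def pd1 (f : ℝ × ℝ → ℝ) (p : ℝ × ℝ) : ℝ := fderiv ℝ f p (1, 0)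

/-- Second partial derivative (direction `(0,1)`). -/
noncomputable def pd2 (f : ℝ × ℝ → ℝ) (p : ℝ × ℝ) : ℝ := fderiv ℝ f p (0, 1)

/-- Linearized Monge–Ampère operator `M_z w = z₁₁w₂₂ + z₂₂w₁₁ − 2z₁₂w₁₂`. -/
noncomputable def Mop (z w : ℝ × ℝ → ℝ) (p : ℝ × ℝ) : ℝ :=
  pd1 (pd1 z) p * pd2 (pd2 w) p + pd2 (pd2 z) p * pd1 (pd1 w) p
    - 2 * pd1 (pd2 z) p * pd1 (pd2 w) p

/-- Doubly periodic (periods `(1,0)` and `(0,1)`). -/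
def DPer (f : ℝ × ℝ → ℝ) : Prop :=
  ∀ p, f (p + ((1 : ℝ), (0 : ℝ))) = f p ∧ f (p + ((0 : ℝ), (1 : ℝ))) = f p

/-- Mean value over the unit period cell `[0,1]²`. -/
noncomputable def unitAvg (f : ℝ × ℝ → ℝ) : ℝ :=
  ∫ u in (0:ℝ)..1, ∫ v in (0:ℝ)..1, f (u, v)

abbrev Sm (f : ℝ × ℝ → ℝ) : Prop := ContDiff ℝ (⊤ : ℕ∞) f

lemma Sm.pd1 {f : ℝ × ℝ → ℝ} (h : Sm f) : Sm (pd1 f) := by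
  have h1 : ContDiff ℝ (⊤ : ℕ∞) (fderiv ℝ f) := h.fderiv_right (by simp)
  exact h1.clm_apply contDiff_const

lemma Sm.pd2 {f : ℝ × ℝ → ℝ} (h : Sm f) : Sm (pd2 f) := by
  have h1 : ContDiff ℝ (⊤ : ℕ∞) (fderiv ℝ f) := h.fderiv_right (by simp)
  exact h1.clm_apply contDiff_const

lemma Sm.diffAt {f : ℝ × ℝ → ℝ} (h : Sm f) (p) : DifferentiableAt ℝ f p :=
  (h.differentiable (by simp)) p

lemma pd_comm {f : ℝ × ℝ → ℝ} (h : Sm f) (p) : pd2 (pd1 f) p = pd1 (pd2 f) p := by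
  have h1 : ContDiff ℝ (⊤ : ℕ∞) (fderiv ℝ f) := h.fderiv_right (by simp)
  have hd : DifferentiableAt ℝ (fderiv ℝ f) p := (h1.differentiable (by simp)) p
  have hs : IsSymmSndFDerivAt ℝ f p := by
    apply ContDiffAt.isSymmSndFDerivAt (n := (⊤ : ℕ∞)) h.contDiffAt
    simp
    exact WithTop.coe_le_coe.mpr (le_top : (2 : ℕ∞) ≤ ⊤)
  have key : ∀ v w : ℝ × ℝ, fderiv ℝ (fun q => fderiv ℝ f q v) p w
      = fderiv ℝ (fderiv ℝ f) p w v := by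
    intro v w
    rw [fderiv_clm_apply hd (differentiableAt_const _)]
    simp
  change fderiv ℝ (fun q => fderiv ℝ f q (1,0)) p (0,1)
    = fderiv ℝ (fun q => fderiv ℝ f q (0,1)) p (1,0)
  rw [key, key]
  exact hs _ _

lemma pd1_add {f g : ℝ × ℝ → ℝ} (hf : Sm f) (hg : Sm g) (p) :
    pd1 (fun q => f q + g q) p = pd1 f p + pd1 g p := by
  simp [pd1, fderiv_fun_add (hf.diffAt p) (hg.diffAt p)]
lemma pd2_add {f g : ℝ × ℝ → ℝ} (hf : Sm f) (hg : Sm g) (p) :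
    pd2 (fun q => f q + g q) p = pd2 f p + pd2 g p := by
  simp [pd2, fderiv_fun_add (hf.diffAt p) (hg.diffAt p)]
lemma pd1_sub {f g : ℝ × ℝ → ℝ} (hf : Sm f) (hg : Sm g) (p) :
    pd1 (fun q => f q - g q) p = pd1 f p - pd1 g p := by
  simp [pd1, fderiv_fun_sub (hf.diffAt p) (hg.diffAt p)]
lemma pd2_sub {f g : ℝ × ℝ → ℝ} (hf : Sm f) (hg : Sm g) (p) :
    pd2 (fun q => f q - g q) p = pd2 f p - pd2 g p := by
  simp [pd2, fderiv_fun_sub (hf.diffAt p) (hg.diffAt p)]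
lemma pd1_mul {f g : ℝ × ℝ → ℝ} (hf : Sm f) (hg : Sm g) (p) :
    pd1 (fun q => f q * g q) p = f p * pd1 g p + g p * pd1 f p := by
  simp [pd1, fderiv_fun_mul (hf.diffAt p) (hg.diffAt p)]
lemma pd2_mul {f g : ℝ × ℝ → ℝ} (hf : Sm f) (hg : Sm g) (p) :
    pd2 (fun q => f q * g q) p = f p * pd2 g p + g p * pd2 f p := by
  simp [pd2, fderiv_fun_mul (hf.diffAt p) (hg.diffAt p)]
lemma pd1_cmul {g : ℝ × ℝ → ℝ} (c : ℝ) (hg : Sm g) (p) :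
    pd1 (fun q => c * g q) p = c * pd1 g p := by
  simp [pd1, fderiv_const_mul (hg.diffAt p)]
lemma pd2_cmul {g : ℝ × ℝ → ℝ} (c : ℝ) (hg : Sm g) (p) :
    pd2 (fun q => c * g q) p = c * pd2 g p := by
  simp [pd2, fderiv_const_mul (hg.diffAt p)]

lemma fderiv_per {f : ℝ × ℝ → ℝ} {a : ℝ × ℝ} (h : ∀ p, f (p + a) = f p) (p) :
    fderiv ℝ f (p + a) = fderiv ℝ f p := by
  rw [← fderiv_comp_add_right]
  simp [h]

lemma DPer.pd1 {f : ℝ × ℝ → ℝ} (h : DPer f) : DPer (pd1 f) := fun p =>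
  ⟨by simp only [_root_.pd1]; rw [fderiv_per fun p => (h p).1],
   by simp only [_root_.pd1]; rw [fderiv_per fun p => (h p).2]⟩
lemma DPer.pd2 {f : ℝ × ℝ → ℝ} (h : DPer f) : DPer (pd2 f) := fun p =>
  ⟨by simp only [_root_.pd2]; rw [fderiv_per fun p => (h p).1],
   by simp only [_root_.pd2]; rw [fderiv_per fun p => (h p).2]⟩

lemma int_pd2 {f : ℝ × ℝ → ℝ} (h : Sm f) (hp : DPer f) (u : ℝ) :
    ∫ v in (0:ℝ)..1, pd2 f (u, v) = 0 := by
  have hd : ∀ v ∈ Set.uIcc (0:ℝ) 1, HasDerivAt (fun v => f (u, v)) (pd2 f (u, v)) v := by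
    intro v _
    exact (h.diffAt (u, v)).hasFDerivAt.comp_hasDerivAt v
      ((hasDerivAt_const v u).prodMk (hasDerivAt_id v))
  rw [intervalIntegral.integral_eq_sub_of_hasDerivAt hd]
  · have := (hp (u, 0)).2
    simp at this
    simp [this]
  · exact (h.pd2.continuous.comp (by fun_prop : Continuous fun v : ℝ => (u, v))).intervalIntegrable _ _

lemma int_pd1 {f : ℝ × ℝ → ℝ} (h : Sm f) (hp : DPer f) (v : ℝ) :
    ∫ u in (0:ℝ)..1, pd1 f (u, v) = 0 := by
  have hd : ∀ u ∈ Set.uIcc (0:ℝ) 1, HasDerivAt (fun u => f (u, v)) (pd1 f (u, v)) u := by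
    intro u _
    exact (h.diffAt (u, v)).hasFDerivAt.comp_hasDerivAt u
      ((hasDerivAt_id u).prodMk (hasDerivAt_const u v))
  rw [intervalIntegral.integral_eq_sub_of_hasDerivAt hd]
  · have := (hp (0, v)).1
    simp at this
    simp [this]
  · exact (h.pd1.continuous.comp (by fun_prop : Continuous fun u : ℝ => (u, v))).intervalIntegrable _ _

lemma unitAvg_pd2 {f : ℝ × ℝ → ℝ} (h : Sm f) (hp : DPer f) : unitAvg (pd2 f) = 0 := by
  simp [unitAvg, int_pd2 h hp]

lemma unitAvg_pd1 {f : ℝ × ℝ → ℝ} (h : Sm f) (hp : DPer f) : unitAvg (pd1 f) = 0 := by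
  have hc : Continuous (Function.uncurry fun u v : ℝ => pd1 f (u, v)) := h.pd1.continuous
  have hI : IntegrableOn (Function.uncurry fun u v : ℝ => pd1 f (u, v))
      (Set.uIoc 0 1 ×ˢ Set.uIoc 0 1) volume := by
    refine IntegrableOn.mono_set (t := Set.uIcc (0:ℝ) 1 ×ˢ Set.uIcc (0:ℝ) 1) ?_
      (Set.prod_mono Set.uIoc_subset_uIcc Set.uIoc_subset_uIcc)
    exact hc.continuousOn.integrableOn_compact (isCompact_uIcc.prod isCompact_uIcc)
  unfold unitAvg
  rw [intervalIntegral_intervalIntegral_swap (by exact hI)]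
  simp [int_pd1 h hp]

lemma unitAvg_add {f g : ℝ × ℝ → ℝ} (hf : Continuous f) (hg : Continuous g) :
    unitAvg (fun p => f p + g p) = unitAvg f + unitAvg g := by
  have hs : ∀ {k : ℝ × ℝ → ℝ}, Continuous k → ∀ u, IntervalIntegrable (fun v => k (u, v)) volume 0 1 :=
    fun hk u => (hk.comp (by fun_prop : Continuous fun v : ℝ => (u, v))).intervalIntegrable _ _
  have ho : ∀ {k : ℝ × ℝ → ℝ}, Continuous k →
      IntervalIntegrable (fun u => ∫ v in (0:ℝ)..1, k (u, v)) volume 0 1 := fun {k} hk =>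
    (intervalIntegral.continuous_parametric_intervalIntegral_of_continuous'
      (f := fun u v => k (u, v)) hk 0 1).intervalIntegrable _ _
  unfold unitAvg
  simp_rw [fun u => intervalIntegral.integral_add (hs hf u) (hs hg u)]
  exact intervalIntegral.integral_add (ho hf) (ho hg)

lemma unitAvg_cmul {f : ℝ × ℝ → ℝ} (c : ℝ) :
    unitAvg (fun p => c * f p) = c * unitAvg f := by
  simp [unitAvg]

lemma pd1_fst (p) : pd1 (fun q => q.1) p = 1 := by simp [pd1, fderiv_fst]
lemma pd2_fst (p) : pd2 (fun q => q.1) p = 0 := by simp [pd2, fderiv_fst]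
lemma pd1_snd (p) : pd1 (fun q => q.2) p = 0 := by simp [pd1, fderiv_snd]
lemma pd2_snd (p) : pd2 (fun q => q.2) p = 1 := by simp [pd2, fderiv_snd]

lemma Mop_quad {z zt : ℝ × ℝ → ℝ} (e f g : ℝ) (hzt : Sm zt) (p) :
    Mop z (fun q => zt q + e / 2 * q.1 ^ 2 + f * q.1 * q.2 + g / 2 * q.2 ^ 2) p
    = Mop z zt p + g * pd1 (pd1 z) p + e * pd2 (pd2 z) p - 2 * f * pd1 (pd2 z) p := by
  have e0 : (fun q : ℝ × ℝ => zt q + e / 2 * q.1 ^ 2 + f * q.1 * q.2 + g / 2 * q.2 ^ 2)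
      = fun q => zt q + ((e / 2) * (q.1 * q.1) + (f * (q.1 * q.2) + (g / 2) * (q.2 * q.2))) := by
    funext q; ring
  have s1 : Sm (fun q : ℝ × ℝ => q.1) := contDiff_fst
  have s2 : Sm (fun q : ℝ × ℝ => q.2) := contDiff_snd
  have t1 := hzt.pd1
  have t2 := hzt.pd2
  have d1 : pd1 (fun q => zt q + ((e / 2) * (q.1 * q.1) + (f * (q.1 * q.2) + (g / 2) * (q.2 * q.2))))
      = fun q => pd1 zt q + (e * q.1 + f * q.2) := by
    funext q
    rw [pd1_add hzt (by unfold Sm; fun_prop), pd1_add (by unfold Sm; fun_prop) (by unfold Sm; fun_prop),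
      pd1_add (by unfold Sm; fun_prop) (by unfold Sm; fun_prop), pd1_cmul _ (s1.mul s1),
      pd1_cmul _ (s1.mul s2), pd1_cmul _ (s2.mul s2), pd1_mul s1 s1, pd1_mul s1 s2, pd1_mul s2 s2,
      pd1_fst, pd1_snd]
    ring
  have d2 : pd2 (fun q => zt q + ((e / 2) * (q.1 * q.1) + (f * (q.1 * q.2) + (g / 2) * (q.2 * q.2))))
      = fun q => pd2 zt q + (f * q.1 + g * q.2) := by
    funext q
    rw [pd2_add hzt (by unfold Sm; fun_prop), pd2_add (by unfold Sm; fun_prop) (by unfold Sm; fun_prop),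
      pd2_add (by unfold Sm; fun_prop) (by unfold Sm; fun_prop), pd2_cmul _ (s1.mul s1),
      pd2_cmul _ (s1.mul s2), pd2_cmul _ (s2.mul s2), pd2_mul s1 s1, pd2_mul s1 s2, pd2_mul s2 s2,
      pd2_fst, pd2_snd]
    ring
  unfold Mop
  rw [e0, d1, d2, pd1_add t1 (by unfold Sm; fun_prop), pd2_add t2 (by unfold Sm; fun_prop),
    pd1_add t2 (by unfold Sm; fun_prop), pd1_add (by unfold Sm; fun_prop) (by unfold Sm; fun_prop),
    pd2_add (by unfold Sm; fun_prop) (by unfold Sm; fun_prop),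
    pd1_add (by unfold Sm; fun_prop) (by unfold Sm; fun_prop),
    pd1_cmul _ s1, pd1_cmul _ s2, pd1_cmul _ s1, pd1_cmul _ s2, pd2_cmul _ s1, pd2_cmul _ s2,
    pd1_fst, pd1_snd, pd2_fst, pd2_snd]
  ring

/-- the effective-strain constraint `E₁₁g + E₂₂e − 2E₁₂f = 0`
satisfied by any effective infinitesimal isometry `(e,f,g)` of a smooth
doubly periodic graph admitting a periodic infinitesimal isometry `ż`. -/
theorem stmt4 (z zd zt : ℝ × ℝ → ℝ) (e f g : ℝ)
    (hz : ContDiff ℝ (⊤ : ℕ∞) z) (hzd : ContDiff ℝ (⊤ : ℕ∞) zd) (hzt : ContDiff ℝ (⊤ : ℕ∞) zt)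
    (hzp : DPer z) (hzdp : DPer zd) (hztp : DPer zt)
    (hiso : ∀ p, Mop z zd p = 0)
    (heff : ∀ p, Mop z
      (fun q => zt q + e / 2 * q.1 ^ 2 + f * q.1 * q.2 + g / 2 * q.2 ^ 2) p = 0) :
    (- unitAvg fun p => pd1 z p * pd1 zd p) * g
      + (- unitAvg fun p => pd2 z p * pd2 zd p) * e
      - 2 * ((- unitAvg fun p => pd1 z p * pd2 zd p + pd2 z p * pd1 zd p) / 2) * f
      = 0 := by
  have hZ : Sm z := hz
  have hD : Sm zd := hzd
  have hT : Sm zt := hzt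
  have z1 := hZ.pd1
  have z2 := hZ.pd2
  have z11 := z1.pd1
  have z12 := z2.pd1
  have z22 := z2.pd2
  have a1 := hD.pd1
  have a2 := hD.pd2
  have b1 := hT.pd1
  have b2 := hT.pd2
  have cP1 := (z22.mul b1).sub (z12.mul b2)
  have cP2 := (z22.mul a1).sub (z12.mul a2)
  have cP3 := (contDiff_const (c := g) |>.mul z1).sub (contDiff_const (c := f) |>.mul z2)
  have cQ1 := (z11.mul b2).sub (z12.mul b1)
  have cQ2 := (z11.mul a2).sub (z12.mul a1)
  have cQ3 := (contDiff_const (c := e) |>.mul z2).sub (contDiff_const (c := f) |>.mul z1)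
  set P : ℝ × ℝ → ℝ := fun q =>
    (zd q * (pd2 (pd2 z) q * pd1 zt q - pd1 (pd2 z) q * pd2 zt q)
    - zt q * (pd2 (pd2 z) q * pd1 zd q - pd1 (pd2 z) q * pd2 zd q))
    + zd q * (g * pd1 z q - f * pd2 z q) with hP
  set Q : ℝ × ℝ → ℝ := fun q =>
    (zd q * (pd1 (pd1 z) q * pd2 zt q - pd1 (pd2 z) q * pd1 zt q)
    - zt q * (pd1 (pd1 z) q * pd2 zd q - pd1 (pd2 z) q * pd1 zd q))
    + zd q * (e * pd2 z q - f * pd1 z q) with hQ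
  have sP : Sm P := ((hD.mul cP1).sub (hT.mul cP2)).add (hD.mul cP3)
  have sQ : Sm Q := ((hD.mul cQ1).sub (hT.mul cQ2)).add (hD.mul cQ3)
  have pP : DPer P := by
    intro p
    constructor
    · simp only [hP, (hzdp p).1, (hztp p).1, (hzp.pd1 p).1, (hzp.pd2 p).1, (hzp.pd2.pd2 p).1,
        (hzp.pd2.pd1 p).1, (hzdp.pd1 p).1, (hzdp.pd2 p).1, (hztp.pd1 p).1, (hztp.pd2 p).1]
    · simp only [hP, (hzdp p).2, (hztp p).2, (hzp.pd1 p).2, (hzp.pd2 p).2, (hzp.pd2.pd2 p).2,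
        (hzp.pd2.pd1 p).2, (hzdp.pd1 p).2, (hzdp.pd2 p).2, (hztp.pd1 p).2, (hztp.pd2 p).2]
  have pQ : DPer Q := by
    intro p
    constructor
    · simp only [hQ, (hzdp p).1, (hztp p).1, (hzp.pd1 p).1, (hzp.pd2 p).1, (hzp.pd1.pd1 p).1,
        (hzp.pd2.pd1 p).1, (hzdp.pd1 p).1, (hzdp.pd2 p).1, (hztp.pd1 p).1, (hztp.pd2 p).1]
    · simp only [hQ, (hzdp p).2, (hztp p).2, (hzp.pd1 p).2, (hzp.pd2 p).2, (hzp.pd1.pd1 p).2,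
        (hzp.pd2.pd1 p).2, (hzdp.pd1 p).2, (hzdp.pd2 p).2, (hztp.pd1 p).2, (hztp.pd2 p).2]
  have key : ∀ p, pd1 P p + pd2 Q p =
      g * (pd1 z p * pd1 zd p) + (e * (pd2 z p * pd2 zd p)
        + (-f) * (pd1 z p * pd2 zd p + pd2 z p * pd1 zd p)) := by
    intro p
    have h1 := hiso p
    have h2 := heff p
    rw [Mop_quad e f g hT] at h2
    have c3 : pd2 (pd1 (pd2 z)) p = pd1 (pd2 (pd2 z)) p := pd_comm z2 p
    have c4 : pd2 (pd1 (pd1 z)) p = pd1 (pd1 (pd2 z)) p := by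
      rw [pd_comm z1 p, funext (pd_comm hZ)]
    rw [hP, hQ, pd1_add ((hD.mul cP1).sub (hT.mul cP2)) (hD.mul cP3),
      pd1_sub (hD.mul cP1) (hT.mul cP2), pd1_mul hD cP1, pd1_mul hT cP2, pd1_mul hD cP3,
      pd1_sub (z22.mul b1) (z12.mul b2), pd1_sub (z22.mul a1) (z12.mul a2),
      pd1_sub (contDiff_const.mul z1) (contDiff_const.mul z2),
      pd1_mul z22 b1, pd1_mul z12 b2, pd1_mul z22 a1, pd1_mul z12 a2, pd1_cmul _ z1, pd1_cmul _ z2,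
      pd2_add ((hD.mul cQ1).sub (hT.mul cQ2)) (hD.mul cQ3),
      pd2_sub (hD.mul cQ1) (hT.mul cQ2), pd2_mul hD cQ1, pd2_mul hT cQ2, pd2_mul hD cQ3,
      pd2_sub (z11.mul b2) (z12.mul b1), pd2_sub (z11.mul a2) (z12.mul a1),
      pd2_sub (contDiff_const.mul z2) (contDiff_const.mul z1),
      pd2_mul z11 b2, pd2_mul z12 b1, pd2_mul z11 a2, pd2_mul z12 a1, pd2_cmul _ z1, pd2_cmul _ z2,
      c3, c4, pd_comm hZ, pd_comm hD, pd_comm hT]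
    unfold Mop at h1 h2
    linear_combination zd p * h2 - zt p * h1
  have hsum := unitAvg_add sP.pd1.continuous sQ.pd2.continuous
  have k1 := (z1.mul a1).continuous
  have k2 := (z2.mul a2).continuous
  have k3 := ((z1.mul a2).add (z2.mul a1)).continuous
  have m1 : Continuous (fun p => g * (pd1 z p * pd1 zd p)) := continuous_const.mul k1
  have m2 : Continuous (fun p => e * (pd2 z p * pd2 zd p)) := continuous_const.mul k2
  have m3 : Continuous (fun p => (-f) * (pd1 z p * pd2 zd p + pd2 z p * pd1 zd p)) :=
    continuous_const.mul k3
  rw [unitAvg_pd1 sP pP, unitAvg_pd2 sQ pQ, funext key, unitAvg_add m1 (by fun_prop),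
    unitAvg_add m2 m3, unitAvg_cmul, unitAvg_cmul, unitAvg_cmul] at hsum
  linear_combination -hsum
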